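/- Fix integers a, b with 1 ≤ a ≤ b, and a positive integer n, and let k', k'' be integers with 1 ≤ k' < k'' such that π(⌊(n − a·k'')/b⌋) = k' and π(⌊(n − a·k')/b⌋) = k''. Then k'' = k' + 1. -/

import Mathlib

theorem Nat.primeCounting_succ_eq (x : ℕ) :
    Nat.primeCounting (x + 1) = Nat.primeCounting x + if (x + 1).Prime then 1 else 0 :=
  Nat.count_succ ..

theorem Nat.primeCounting_add_le_add (x d : ℕ) :
    Nat.primeCounting (x + d) ≤ Nat.primeCounting x + d := by
  induction d with
  | zero => simp
  | succ d ih =>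
    rw [← add_assoc, Nat.primeCounting_succ_eq]
    split_ifs <;> omega

/-- Of two consecutive integers greater than `2`, at most one is prime. -/
theorem Nat.primeCounting_add_two_le {x : ℕ} (hx : 2 ≤ x) :
    Nat.primeCounting (x + 2) ≤ Nat.primeCounting x + 1 := by
  have h₁ := Nat.primeCounting_succ_eq x
  have h₂ : Nat.primeCounting (x + 2) = _ := Nat.primeCounting_succ_eq (x + 1)
  split_ifs at h₁ h₂ with hp hq
  · have := hp.eq_two_or_odd
    have := hq.eq_two_or_odd
    omega
  all_goals omega

theorem stmt_13 (a b n k' k'' : ℕ) (ha : 1 ≤ a) (hab : a ≤ b) (hn : 0 < n)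
    (hk' : 1 ≤ k') (hlt : k' < k'')
    (h1 : Nat.primeCounting ((n - a * k'') / b) = k')
    (h2 : Nat.primeCounting ((n - a * k') / b) = k'') :
    k'' = k' + 1 := by
  obtain ⟨d, rfl⟩ := Nat.exists_eq_add_of_lt hlt
  set m := (n - a * (k' + d + 1)) / b with hm
  have hm2 : 2 ≤ m := by
    by_contra! h
    have : Nat.primeCounting m = 0 := by interval_cases m <;> simp
    omega
  have hM : (n - a * k') / b ≤ m + (d + 1) := by
    rw [hm, ← Nat.add_mul_div_right _ _ (by omega : 0 < b)]
    apply Nat.div_le_div_right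
    have : a * (d + 1) ≤ (d + 1) * b := by
      rw [mul_comm]
      exact Nat.mul_le_mul_left _ hab
    have : a * (k' + d + 1) = a * k' + a * (d + 1) := by ring
    omega
  have hmono := Nat.monotone_primeCounting hM
  rcases d with _ | e
  · rfl
  · have h3 := Nat.primeCounting_add_le_add (m + 2) e
    have h4 := Nat.primeCounting_add_two_le hm2
    rw [show m + (e + 1 + 1) = m + 2 + e by ring] at hmono
    omega
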